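/- In the polynomial ring ℤ[q], define a_{2n+1} = 0 for all n and a_{2n} = Σ over Dyck paths P of length 2n of Π over up steps of P starting at height h of (1 − q^{h+1}), and define b_n = Σ_{k=0}^{⌊n/2⌋} (−1)^k · C(n−k, k) · a_{n−2k}. Then for every natural number n, b_{2n+1} = 0 and b_{2n} = Σ over Schröder paths S of length 2n of (−1)^{(number of level steps of S)} · Π over up steps of S starting at height h of (1 − q^{h+1}). -/

import Mathlib

open Finset

inductive Step : Type
  | U | L | D
deriving DecidableEq

instance : Fintype Step where
  elems := {Step.U, Step.L, Step.D}
  complete := by intro x; cases x <;> simp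

/-- The vertical displacement of a step: up = +1, level = 0, down = -1. -/
def Step.val : Step → ℤ
  | .U => 1
  | .L => 0
  | .D => -1

/-- The partial sum of the step values of the first `i` steps;
this is the height at which step `i` starts. -/
def hsum {n : ℕ} (P : Fin n → Step) (i : ℕ) : ℤ :=
  ∑ j ∈ Finset.univ.filter (fun j : Fin n => (j : ℕ) < i), (P j).val

/-- A Motzkin path: all partial sums nonnegative and total sum 0. -/
abbrev IsMotzkin {n : ℕ} (P : Fin n → Step) : Prop :=
  (∀ i : Fin (n+1), 0 ≤ hsum P (i : ℕ)) ∧ hsum P n = 0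

/-- A Motzkin prefix of final height `k`: all partial sums nonnegative, total sum `k`. -/
abbrev IsMPrefix {n : ℕ} (P : Fin n → Step) (k : ℕ) : Prop :=
  (∀ i : Fin (n+1), 0 ≤ hsum P (i : ℕ)) ∧ hsum P n = (k : ℤ)

/-- `[h]_q = 1 + q + ... + q^(h-1)`. -/
def geo {R : Type*} [CommSemiring R] (q : R) (h : ℤ) : R :=
  ∑ i ∈ Finset.range h.toNat, q ^ i

/-- The Gaussian (q-)binomial coefficient, via the q-Pascal recurrence. -/
def qbinom {R : Type*} [CommSemiring R] (q : R) : ℕ → ℕ → R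
  | _, 0 => 1
  | 0, _+1 => 0
  | n+1, k+1 => qbinom q n k + q ^ (k+1) * qbinom q n (k+1)

/-- The binomial coefficient with integer lower argument, zero on negative arguments. -/
def ch (m : ℕ) (j : ℤ) : ℤ := if 0 ≤ j then m.choose j.toNat else 0

open Polynomial

/-- `aSeq m` is the generating function of Dyck paths of length `m`, with weight
`1 - q^(h+1)` on each up step starting at height `h` (it vanishes for odd `m`,
since there are no Dyck paths of odd length). -/
noncomputable def aSeq (m : ℕ) : Polynomial ℤ :=
  ∑ P ∈ Finset.univ.filter
      (fun P : Fin m → Step => IsMotzkin P ∧ ∀ i, P i ≠ Step.L),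
    ∏ i, (if P i = Step.U
          then 1 - (X : Polynomial ℤ) ^ ((hsum P (i : ℕ)).toNat + 1) else 1)

/-- `bSeq n = ∑_k (-1)^k C(n-k,k) aSeq (n-2k)`. -/
noncomputable def bSeq (n : ℕ) : Polynomial ℤ :=
  ∑ k ∈ Finset.range (n/2 + 1),
    (-1 : Polynomial ℤ) ^ k * ((n - k).choose k : Polynomial ℤ) * aSeq (n - 2*k)

lemma hsum_zero' {m : ℕ} (P : Fin m → Step) : hsum P 0 = 0 := by
  simp [hsum]

lemma hsum_cons' {m : ℕ} (s : Step) (P : Fin m → Step) (i : ℕ) :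
    hsum (Fin.cons s P : Fin (m+1) → Step) (i+1) = s.val + hsum P i := by
  simp [hsum, Finset.sum_filter, Fin.sum_univ_succ]

def lev {m : ℕ} (P : Fin m → Step) : ℕ := (Finset.univ.filter (fun i => P i = Step.L)).card

lemma lev_cons {m : ℕ} (s : Step) (P : Fin m → Step) :
    lev (Fin.cons s P : Fin (m+1) → Step) = (if s = Step.L then 1 else 0) + lev P := by
  simp only [lev, Finset.card_filter, Fin.sum_univ_succ, Fin.cons_zero, Fin.cons_succ]

def Good {m : ℕ} (P : Fin m → Step) (k : ℕ) (h : ℤ) : Prop :=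
  (∀ i : Fin (m+1), 0 ≤ h + hsum P (i : ℕ)) ∧ h + hsum P m = 0 ∧ lev P = k

lemma good_iff {m : ℕ} (P : Fin m → Step) (k : ℕ) (h : ℤ) : Good P k h ↔
    ((∀ i : Fin (m+1), 0 ≤ h + hsum P (i : ℕ)) ∧ h + hsum P m = 0 ∧ lev P = k) := by
  constructor <;> exact fun x => x

lemma good_cons {m : ℕ} (s : Step) (P : Fin m → Step) (k : ℕ) (h : ℤ) :
    Good (Fin.cons s P : Fin (m+1) → Step) k h ↔ 0 ≤ h ∧
      ((∀ i : Fin (m+1), 0 ≤ (h + s.val) + hsum P (i : ℕ)) ∧ (h + s.val) + hsum P m = 0 ∧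
        (if s = Step.L then 1 else 0) + lev P = k) := by
  unfold Good
  rw [Fin.forall_fin_succ, lev_cons, hsum_cons']
  simp [hsum_cons', hsum_zero', add_assoc, and_assoc]

noncomputable def wt {m : ℕ} (P : Fin m → Step) (h : ℤ) : Polynomial ℤ :=
  ∏ i, (if P i = Step.U
          then 1 - (X : Polynomial ℤ) ^ ((h + hsum P (i : ℕ)).toNat + 1) else 1)

lemma wt_cons {m : ℕ} (s : Step) (P : Fin m → Step) (h : ℤ) :
    wt (Fin.cons s P : Fin (m+1) → Step) h =
      (if s = Step.U then 1 - (X : Polynomial ℤ) ^ (h.toNat + 1) else 1) * wt P (h + s.val) := by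
  simp [wt, Fin.prod_univ_succ, hsum_cons', hsum_zero', add_assoc]

open Classical in
noncomputable def G (m k : ℕ) (h : ℤ) : Polynomial ℤ :=
  ∑ P : Fin m → Step, if Good P k h then wt P h else 0

lemma sum_step (f : Step → Polynomial ℤ) : ∑ s, f s = f .U + f .L + f .D := by
  have : (Finset.univ : Finset Step) = {Step.U, Step.L, Step.D} := rfl
  rw [this]; simp [add_assoc]

lemma G_zero (k : ℕ) (h : ℤ) : G 0 k h = if k = 0 ∧ h = 0 then 1 else 0 := by
  classical
  simp only [G, Good, lev, wt, hsum, Finset.univ_unique, Finset.sum_singleton]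
  simp
  congr 1
  apply propext
  constructor
  · rintro ⟨_, h1, h2⟩; exact ⟨h2.symm, h1⟩
  · rintro ⟨h2, h1⟩; exact ⟨h1.ge, h1, h2.symm⟩

lemma G_succ (m k : ℕ) (h : ℤ) : G (m+1) k h =
    if 0 ≤ h then (1 - (X : Polynomial ℤ) ^ (h.toNat + 1)) * G m k (h+1)
      + (if k = 0 then 0 else G m (k-1) h) + G m k (h-1) else 0 := by
  classical
  unfold G
  rw [← (Fin.consEquiv (fun _ : Fin (m+1) => Step)).sum_comp, Fintype.sum_prod_type, sum_step]
  simp only [Fin.consEquiv, Equiv.coe_fn_mk, good_cons, wt_cons]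
  by_cases h0 : 0 ≤ h
  swap
  · simp [h0]
  by_cases hk : k = 0
  · subst hk
    simp [h0, Step.val, good_iff, Finset.mul_sum, sub_eq_add_neg]
  · obtain ⟨k, rfl⟩ := Nat.exists_eq_succ_of_ne_zero hk
    have e : ∀ x : ℕ, 1 + x = k + 1 ↔ x = k := by intro x; omega
    simp [h0, Step.val, good_iff, Finset.mul_sum, sub_eq_add_neg, e]

lemma G_choose (m : ℕ) : ∀ (k : ℕ) (h : ℤ), G m k h = (m.choose k : Polynomial ℤ) * G (m-k) 0 h := by
  induction m with
  | zero => intro k h; cases k <;> simp [G_zero]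
  | succ m ih =>
    intro k h
    cases k with
    | zero => simp
    | succ k =>
      rw [G_succ]
      simp only [Nat.add_sub_cancel, Nat.succ_ne_zero, if_false, Nat.add_sub_add_right]
      rw [ih (k+1) (h+1), ih (k+1) (h-1), ih k h]
      rcases Nat.lt_or_ge k m with hk | hk
      · have e : m - k = (m - (k+1)) + 1 := by omega
        rw [e, G_succ, Nat.choose_succ_succ']
        simp only [if_true]
        split_ifs <;> push_cast <;> ring
      · rw [Nat.choose_succ_succ, Nat.choose_eq_zero_of_lt (show m < k+1 by omega)]
        rw [Nat.sub_eq_zero_of_le hk, G_zero]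
        split_ifs with h1 h2 <;> simp
        omega

lemma G_odd (m : ℕ) : ∀ h : ℤ, (m + h) % 2 = 1 → G m 0 h = 0 := by
  induction m with
  | zero => intro h hh; rw [G_zero, if_neg]; rintro ⟨_, rfl⟩; simp at hh
  | succ m ih =>
    intro h hh
    push_cast at hh
    rw [G_succ, ih (h+1) (by omega), ih (h-1) (by omega)]; simp

lemma aSeq_eq (m : ℕ) : aSeq m = G m 0 0 := by
  classical
  unfold aSeq G
  rw [Finset.sum_filter]
  refine Finset.sum_congr rfl fun P _ => ?_
  simp [Good, wt, lev, Finset.filter_eq_empty_iff, and_assoc]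

lemma G_path (m N : ℕ) : ∑ P ∈ Finset.univ.filter
              (fun P : Fin m → Step => IsMotzkin P ∧
                m + (Finset.univ.filter (fun i => P i = Step.L)).card = N),
            (-1 : Polynomial ℤ) ^ (Finset.univ.filter (fun i => P i = Step.L)).card *
            ∏ i, (if P i = Step.U
                  then 1 - (X : Polynomial ℤ) ^ ((hsum P (i : ℕ)).toNat + 1) else 1)
    = if m ≤ N then (-1) ^ (N - m) * G m (N - m) 0 else 0 := by
  classical
  rw [Finset.sum_filter]
  split_ifs with hm
  · unfold G
    rw [Finset.mul_sum]
    refine Finset.sum_congr rfl fun P _ => ?_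
    have e : (IsMotzkin P ∧ m + (Finset.univ.filter (fun i => P i = Step.L)).card = N) ↔
        Good P (N - m) 0 := by
      have : m + (Finset.univ.filter (fun i => P i = Step.L)).card = N ↔ lev P = N - m := by
        unfold lev; omega
      simp only [Good, IsMotzkin, this, zero_add, and_assoc]
    rw [if_congr e rfl rfl]
    split_ifs with hg
    · have := hg.2.2
      unfold lev at this
      rw [this]; simp [wt]
    · simp
  · refine Finset.sum_eq_zero fun P _ => if_neg ?_
    rintro ⟨_, h⟩; omega

/-- `bSeq` vanishes in odd degree, and `bSeq (2n)` is the generating function of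
Schröder paths of length `2n`, with weight `-1` on each level step and
`1 - q^(h+1)` on each up step starting at height `h`.  A Schröder path of
length `2n` is encoded by its number of steps `m` and its step sequence
`P : Fin m → Step`, where a level step has length `2`, so that
`m + (number of level steps) = 2n`. -/
theorem stmt19 (n : ℕ) :
    bSeq (2*n + 1) = 0 ∧
    bSeq (2*n)
      = ∑ m ∈ Finset.range (2*n + 1),
          ∑ P ∈ Finset.univ.filter
              (fun P : Fin m → Step => IsMotzkin P ∧
                m + (Finset.univ.filter (fun i => P i = Step.L)).card = 2*n),
            (-1 : Polynomial ℤ) ^ (Finset.univ.filter (fun i => P i = Step.L)).card *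
            ∏ i, (if P i = Step.U
                  then 1 - (X : Polynomial ℤ) ^ ((hsum P (i : ℕ)).toNat + 1) else 1) := by
  constructor
  · unfold bSeq
    refine Finset.sum_eq_zero fun k hk => ?_
    rw [Finset.mem_range] at hk
    rw [aSeq_eq, G_odd _ _ (by omega), mul_zero]
  · have h1 : bSeq (2*n) = ∑ k ∈ Finset.range (2*n+1),
        (-1 : Polynomial ℤ) ^ k * G (2*n - k) k 0 := by
      unfold bSeq
      rw [show 2*n/2 = n by omega]
      rw [← Finset.sum_subset (s₁ := Finset.range (n+1)) (s₂ := Finset.range (2*n+1))]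
      · refine Finset.sum_congr rfl fun k hk => ?_
        rw [G_choose, aSeq_eq, show 2*n - k - k = 2*n - 2*k by omega, mul_assoc]
      · intro x hx; rw [Finset.mem_range] at *; omega
      · intro x hx hx'
        rw [Finset.mem_range] at *
        rw [G_choose, Nat.choose_eq_zero_of_lt (by omega)]; simp
    rw [h1, ← Finset.sum_range_reflect]
    refine Finset.sum_congr rfl fun m hm => ?_
    rw [Finset.mem_range] at hm
    rw [G_path, if_pos (by omega)]
    rw [show 2*n + 1 - 1 - m = 2*n - m by omega, show 2*n - (2*n - m) = m by omega]
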